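/- arXiv:1712.10119 — 4 statements merged into one kernel-verified Lean document; each statement's English description precedes it below -/
import Mathlib

section
/- Let X be a real Banach space and T : X ⇉ X* a maximal p-monotone multivalued operator, where p ≥ 1 is an integer. Then for every integer q ≥ p: (1) the q-monotone polar T^{μ_q} is q-monotone; (2) if moreover T is q-monotone, then T is maximal q-monotone. -/
open scoped BigOperators

noncomputable section

variable {X : Type*} [NormedAddCommGroup X] [NormedSpace ℝ X]

/-- The cyclic sum `∑_{i=0}^{p} ⟨x_{i+1} − x_i, x_i*⟩` (indices mod `p+1`). -/
def cyclicSum (p : ℕ) (a : Fin (p + 1) → X × (X →L[ℝ] ℝ)) : ℝ :=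
  ∑ i : Fin (p + 1), (a i).2 ((a (i + 1)).1 - (a i).1)

/-- `T` is `p`-monotone. -/
def IsPMonotone (p : ℕ) (T : Set (X × (X →L[ℝ] ℝ))) : Prop :=
  ∀ a : Fin (p + 1) → X × (X →L[ℝ] ℝ), (∀ i, a i ∈ T) → cyclicSum p a ≤ 0

/-- The `p`-monotone polar `T^{μ_p}`. -/
def pPolar (p : ℕ) (T : Set (X × (X →L[ℝ] ℝ))) : Set (X × (X →L[ℝ] ℝ)) :=
  {z | ∀ a : Fin (p + 1) → X × (X →L[ℝ] ℝ),
    a 0 = z → (∀ i, i ≠ 0 → a i ∈ T) → cyclicSum p a ≤ 0}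

/-- `T` is maximal `p`-monotone. -/
def IsMaxPMonotone (p : ℕ) (T : Set (X × (X →L[ℝ] ℝ))) : Prop :=
  IsPMonotone p T ∧
    ∀ S : Set (X × (X →L[ℝ] ℝ)), IsPMonotone p S → T ⊆ S → S = T

/-- The domain of a multivalued operator. -/
def opDom (T : Set (X × (X →L[ℝ] ℝ))) : Set X := {x | ∃ xs, (x, xs) ∈ T}

/-- `T` is pre-maximal `p`-monotone: `T` and `T^{μ_p}` are `p`-monotone. -/
def IsPreMaxPMonotone (p : ℕ) (T : Set (X × (X →L[ℝ] ℝ))) : Prop :=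
  IsPMonotone p T ∧ IsPMonotone p (pPolar p T)

/-- The normal cone operator of a set `C ⊆ X`. -/
def normalCone (C : Set X) : Set (X × (X →L[ℝ] ℝ)) :=
  {z | z.1 ∈ C ∧ ∀ y ∈ C, z.2 (y - z.1) ≤ 0}

/-- The monotone polar `T^{μ}`. -/
def monoPolar (T : Set (X × (X →L[ℝ] ℝ))) : Set (X × (X →L[ℝ] ℝ)) :=
  {z | ∀ w ∈ T, 0 ≤ (z.2 - w.2) (z.1 - w.1)}

/-- `T` is a monotone operator. -/
def IsMonotoneOp (T : Set (X × (X →L[ℝ] ℝ))) : Prop :=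
  ∀ a ∈ T, ∀ b ∈ T, 0 ≤ (a.2 - b.2) (a.1 - b.1)

/-- The operator `T_{p+} : X^{p+1} ⇉ (X*)^{p+1}`. -/
def TpPlus (p : ℕ) (T : Set (X × (X →L[ℝ] ℝ))) :
    Set ((Fin (p + 1) → X) × (Fin (p + 1) → (X →L[ℝ] ℝ))) :=
  {z | ∀ i, ∃ u v, (z.1 i, u) ∈ T ∧ (z.1 (i + 1), v) ∈ T ∧ z.2 i = u - v}

/-- The operator `T_{p−} : X^{p+1} ⇉ (X*)^{p+1}`. -/
def TpMinus (p : ℕ) (T : Set (X × (X →L[ℝ] ℝ))) :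
    Set ((Fin (p + 1) → X) × (Fin (p + 1) → (X →L[ℝ] ℝ))) :=
  {z | ∀ i, ∃ u v, (z.1 i, u) ∈ T ∧ (z.1 (i - 1), v) ∈ T ∧ z.2 i = u - v}

/-- Monotonicity for operators `X^{p+1} ⇉ (X*)^{p+1}` with the product duality pairing. -/
def IsMonotoneBig (p : ℕ)
    (S : Set ((Fin (p + 1) → X) × (Fin (p + 1) → (X →L[ℝ] ℝ)))) : Prop :=
  ∀ a ∈ S, ∀ b ∈ S, 0 ≤ ∑ i : Fin (p + 1), (a.2 i - b.2 i) (a.1 i - b.1 i)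

/-- Maximal monotonicity for operators `X^{p+1} ⇉ (X*)^{p+1}`. -/
def IsMaxMonotoneBig (p : ℕ)
    (S : Set ((Fin (p + 1) → X) × (Fin (p + 1) → (X →L[ℝ] ℝ)))) : Prop :=
  IsMonotoneBig p S ∧
    ∀ S' : Set ((Fin (p + 1) → X) × (Fin (p + 1) → (X →L[ℝ] ℝ))),
      IsMonotoneBig p S' → S ⊆ S' → S' = S

/-- The adjoint operator `T*`: `(x,x*) ∈ T*` iff `⟨x,y*⟩ = ⟨y,x*⟩` for all `(y,y*) ∈ T`. -/
def adjointOp (T : Set (X × (X →L[ℝ] ℝ))) : Set (X × (X →L[ℝ] ℝ)) :=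
  {z | ∀ w ∈ T, w.2 z.1 = z.2 w.1}

/-- The adjoint of an operator `X^{p+1} ⇉ (X*)^{p+1}` w.r.t. the product duality pairing. -/
def adjointBig (p : ℕ)
    (S : Set ((Fin (p + 1) → X) × (Fin (p + 1) → (X →L[ℝ] ℝ)))) :
    Set ((Fin (p + 1) → X) × (Fin (p + 1) → (X →L[ℝ] ℝ))) :=
  {z | ∀ w ∈ S, ∑ i : Fin (p + 1), (w.2 i) (z.1 i) = ∑ i : Fin (p + 1), (z.2 i) (w.1 i)}

/-- The sum of `⟨x_{i+1} − x_i, x_i*⟩` along the walk from `y` through the list to `z`. -/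
def walkSum (z : X × (X →L[ℝ] ℝ)) :
    X × (X →L[ℝ] ℝ) → List (X × (X →L[ℝ] ℝ)) → ℝ
  | y, [] => y.2 (z.1 - y.1)
  | y, b :: l => y.2 (b.1 - y.1) + walkSum z b l

theorem walkSum_append_cons (z w y : X × (X →L[ℝ] ℝ)) (l₁ l₂ : List (X × (X →L[ℝ] ℝ))) :
    walkSum z y (l₁ ++ w :: l₂) = walkSum w y l₁ + walkSum z w l₂ := by
  induction l₁ generalizing y with
  | nil => rfl
  | cons b l ih => simp only [List.cons_append, walkSum, ih, add_assoc]

theorem walkSum_replicate_append_cons (z b y : X × (X →L[ℝ] ℝ)) (k : ℕ)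
    (l : List (X × (X →L[ℝ] ℝ))) :
    walkSum z y (List.replicate k b ++ b :: l) = walkSum z y (b :: l) := by
  induction k generalizing y with
  | zero => rfl
  | succ k ih => simp [List.replicate_succ, walkSum, ih]

theorem walkSum_ofFn (z y : X × (X →L[ℝ] ℝ)) (n : ℕ) (f : Fin n → X × (X →L[ℝ] ℝ)) :
    walkSum z y (List.ofFn f) =
      ∑ i : Fin n, ((Fin.cons y f : Fin (n + 1) → X × (X →L[ℝ] ℝ)) i.castSucc).2
        ((f i).1 - ((Fin.cons y f : Fin (n + 1) → X × (X →L[ℝ] ℝ)) i.castSucc).1) +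
      ((Fin.cons y f : Fin (n + 1) → X × (X →L[ℝ] ℝ)) (Fin.last n)).2
        (z.1 - ((Fin.cons y f : Fin (n + 1) → X × (X →L[ℝ] ℝ)) (Fin.last n)).1) := by
  induction n generalizing y with
  | zero => simp [walkSum]
  | succ n ih =>
    have h : (Fin.cons (f 0) (fun i : Fin n => f i.succ) : Fin (n + 1) → _) = f :=
      Fin.cons_self_tail f
    rw [List.ofFn_succ, walkSum, ih, Fin.sum_univ_succ, h]
    simp only [Fin.castSucc_zero, Fin.cons_zero, Fin.castSucc_succ, Fin.cons_succ,
      ← Fin.succ_last, add_assoc]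

theorem cyclicSum_eq_walkSum (p : ℕ) (a : Fin (p + 1) → X × (X →L[ℝ] ℝ)) :
    cyclicSum p a = walkSum (a 0) (a 0) (List.ofFn fun i : Fin p => a i.succ) := by
  have h : (Fin.cons (a 0) (fun i : Fin p => a i.succ) : Fin (p + 1) → _) = a :=
    Fin.cons_self_tail a
  rw [walkSum_ofFn, h, cyclicSum, Fin.sum_univ_castSucc]
  simp only [Fin.coeSucc_eq_succ, Fin.last_add_one]

theorem cyclicSum_rotate (p : ℕ) (a : Fin (p + 1) → X × (X →L[ℝ] ℝ)) (k : Fin (p + 1)) :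
    cyclicSum p (fun i => a (i + k)) = cyclicSum p a := by
  unfold cyclicSum
  rw [← Equiv.sum_comp (Equiv.addRight k) fun i => (a i).2 ((a (i + 1)).1 - (a i).1)]
  simp only [Equiv.coe_addRight, add_right_comm]

theorem walkSum_nonpos_of_mem_pPolar {p : ℕ} {T : Set (X × (X →L[ℝ] ℝ))}
    {z : X × (X →L[ℝ] ℝ)} (hz : z ∈ pPolar p T) {l : List (X × (X →L[ℝ] ℝ))}
    (hl : ∀ b ∈ l, b ∈ T) (hp : l.length ≤ p) : walkSum z z l ≤ 0 := by
  have exact_length : ∀ m : List (X × (X →L[ℝ] ℝ)), (∀ b ∈ m, b ∈ T) → m.length = p →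
      walkSum z z m ≤ 0 := by
    rintro m hm rfl
    have h := hz (Fin.cons z m.get) rfl (fun i hi => by
      obtain ⟨j, rfl⟩ := Fin.exists_succ_eq_of_ne_zero hi
      exact hm _ (by simp))
    rw [cyclicSum_eq_walkSum] at h
    simpa using h
  cases l with
  | nil => simp [walkSum]
  | cons b l =>
    rw [← walkSum_replicate_append_cons z b z (p - (b :: l).length)]
    apply exact_length
    · intro c hc
      rcases List.mem_append.1 hc with hc | hc
      · rw [List.eq_of_mem_replicate hc]
        exact hl b (by simp)
      · exact hl c hc
    · rw [List.length_append, List.length_replicate]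
      omega

theorem pPolar_anti {p q : ℕ} (hpq : p ≤ q) (T : Set (X × (X →L[ℝ] ℝ))) :
    pPolar q T ⊆ pPolar p T := by
  rintro _ hz a rfl ha
  rw [cyclicSum_eq_walkSum]
  refine walkSum_nonpos_of_mem_pPolar hz (fun b hb => ?_) (by simpa using hpq)
  obtain ⟨i, rfl⟩ := List.mem_ofFn.1 hb
  exact ha _ (Fin.succ_ne_zero i)

theorem isPMonotone_iff_subset_pPolar {p : ℕ} {T : Set (X × (X →L[ℝ] ℝ))} :
    IsPMonotone p T ↔ T ⊆ pPolar p T := by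
  refine ⟨fun h z hz a ha0 ha => h a fun i => ?_, fun h a ha => h (ha 0) a rfl fun i _ => ha i⟩
  by_cases hi : i = 0
  · rwa [hi, ha0]
  · exact ha i hi

theorem IsPMonotone.of_le {p q : ℕ} (hpq : p ≤ q) {T : Set (X × (X →L[ℝ] ℝ))}
    (h : IsPMonotone q T) : IsPMonotone p T :=
  isPMonotone_iff_subset_pPolar.2
    ((isPMonotone_iff_subset_pPolar.1 h).trans (pPolar_anti hpq T))

/-- A closed walk through `z` splits at its visits to `z`. -/
theorem walkSum_nonpos_of_mem_insert {p : ℕ} {T : Set (X × (X →L[ℝ] ℝ))}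
    {z : X × (X →L[ℝ] ℝ)} (hz : z ∈ pPolar p T) (l : List (X × (X →L[ℝ] ℝ)))
    (hl : ∀ b ∈ l, b ∈ insert z T) (hp : l.length ≤ p) : walkSum z z l ≤ 0 := by
  by_cases hmem : z ∈ l
  · obtain ⟨l₁, l₂, rfl⟩ := List.append_of_mem hmem
    have hlen : (l₁ ++ z :: l₂).length = l₁.length + l₂.length + 1 := by
      simp [add_assoc]
    rw [walkSum_append_cons]
    exact add_nonpos
      (walkSum_nonpos_of_mem_insert hz l₁ (fun b hb => hl b (by simp [hb])) (by omega))
      (walkSum_nonpos_of_mem_insert hz l₂ (fun b hb => hl b (by simp [hb])) (by omega))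
  · refine walkSum_nonpos_of_mem_pPolar hz (fun b hb => ?_) hp
    exact (hl b hb).resolve_left fun h => hmem (h ▸ hb)
termination_by l.length
decreasing_by all_goals simp_all

theorem IsPMonotone.insert_of_mem_pPolar {p : ℕ} {T : Set (X × (X →L[ℝ] ℝ))}
    (hT : IsPMonotone p T) {z : X × (X →L[ℝ] ℝ)} (hz : z ∈ pPolar p T) :
    IsPMonotone p (insert z T) := by
  intro a ha
  by_cases h : ∃ k, a k = z
  · obtain ⟨k, rfl⟩ := h
    rw [← cyclicSum_rotate p a k, cyclicSum_eq_walkSum]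
    simp only [zero_add]
    refine walkSum_nonpos_of_mem_insert hz _ (fun b hb => ?_) (by simp)
    obtain ⟨i, rfl⟩ := List.mem_ofFn.1 hb
    exact ha _
  · push Not at h
    exact hT a fun i => (ha i).resolve_left (h i)

theorem IsMaxPMonotone.pPolar_subset {p : ℕ} {T : Set (X × (X →L[ℝ] ℝ))}
    (hT : IsMaxPMonotone p T) : pPolar p T ⊆ T := fun z hz =>
  hT.2 _ (hT.1.insert_of_mem_pPolar hz) (Set.subset_insert z T) ▸ Set.mem_insert z T

/-- If `T` is maximal `p`-monotone and `q ≥ p`, then `T^{μ_q}` is `q`-monotone,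
and if moreover `T` is `q`-monotone then `T` is maximal `q`-monotone. -/
theorem maxPMonotone_qPolar_and_maxQMonotone [CompleteSpace X] (p q : ℕ) (hp : 1 ≤ p)
    (hpq : p ≤ q) (T : Set (X × (X →L[ℝ] ℝ))) (hT : IsMaxPMonotone p T) :
    IsPMonotone q (pPolar q T) ∧ (IsPMonotone q T → IsMaxPMonotone q T) := by
  have hsub : pPolar q T ⊆ T := (pPolar_anti hpq T).trans hT.pPolar_subset
  exact ⟨fun a ha => ha 0 a rfl fun i _ => hsub (ha i),
    fun hq => ⟨hq, fun S hS => hT.2 S (hS.of_le hpq)⟩⟩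
end
end

section
/- Let X be a real Banach space, p ≥ 1 an integer, and T : X ⇉ X* a linear multivalued operator (its graph is a linear subspace of X × X*). If (x,x*) ∈ T^{μ_p}, then t·(x,x*) ∈ T^{μ_p} for every t ∈ ℝ. -/
open scoped BigOperators

noncomputable section

variable {X : Type*} [NormedAddCommGroup X] [NormedSpace ℝ X]

theorem cyclicSum_smul (p : ℕ) (c : ℝ) (a : Fin (p + 1) → X × (X →L[ℝ] ℝ)) :
    cyclicSum p (c • a) = c ^ 2 * cyclicSum p a := by
  simp only [cyclicSum, Finset.mul_sum, Pi.smul_apply, Prod.smul_fst, Prod.smul_snd,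
    ← smul_sub, smul_apply, map_smul, smul_eq_mul]
  exact Finset.sum_congr rfl fun i _ => by ring

theorem continuous_cyclicSum (p : ℕ) :
    Continuous (cyclicSum p : (Fin (p + 1) → X × (X →L[ℝ] ℝ)) → ℝ) := by
  unfold cyclicSum
  fun_prop

theorem isClosed_pPolar (p : ℕ) (T : Set (X × (X →L[ℝ] ℝ))) : IsClosed (pPolar p T) := by
  have h : pPolar p T = ⋂ (a : Fin (p + 1) → X × (X →L[ℝ] ℝ)) (_ : ∀ i, i ≠ 0 → a i ∈ T),
      {z | cyclicSum p (Function.update a 0 z) ≤ 0} := by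
    ext z
    simp only [pPolar, Set.mem_ofPred_eq, Set.mem_iInter]
    refine ⟨fun hz a ha => hz _ (by simp) fun i hi => by simpa [hi] using ha i hi, ?_⟩
    rintro hz a rfl ha
    simpa using hz a ha
  rw [h]
  exact isClosed_iInter fun a => isClosed_iInter fun _ =>
    isClosed_le ((continuous_cyclicSum p).comp (continuous_const.update 0 continuous_id))
      continuous_const

theorem smul_mem_pPolar_of_ne_zero {p : ℕ} {L : Submodule ℝ (X × (X →L[ℝ] ℝ))}
    {z : X × (X →L[ℝ] ℝ)} (hz : z ∈ pPolar p (L : Set (X × (X →L[ℝ] ℝ)))) {t : ℝ}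
    (ht : t ≠ 0) : t • z ∈ pPolar p (L : Set (X × (X →L[ℝ] ℝ))) := by
  intro a h0 ha
  have h := hz (t⁻¹ • a) (by rw [Pi.smul_apply, h0, inv_smul_smul₀ ht])
    fun i hi => L.smul_mem _ (ha i hi)
  rw [cyclicSum_smul] at h
  exact nonpos_of_mul_nonpos_right h (by positivity)

/-- If `T` is linear and `(x,x*) ∈ T^{μ_p}`, then `t • (x,x*) ∈ T^{μ_p}` for all
`t ∈ ℝ`. -/
theorem smul_mem_pPolar_of_linear [CompleteSpace X] (p : ℕ) (hp : 1 ≤ p)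
    (T : Set (X × (X →L[ℝ] ℝ)))
    (hlin : ∃ L : Submodule ℝ (X × (X →L[ℝ] ℝ)), T = ↑L)
    (z : X × (X →L[ℝ] ℝ)) (hz : z ∈ pPolar p T) (t : ℝ) :
    t • z ∈ pPolar p T := by
  obtain ⟨L, rfl⟩ := hlin
  have hclosed : IsClosed {s : ℝ | s • z ∈ pPolar p (L : Set (X × (X →L[ℝ] ℝ)))} :=
    (isClosed_pPolar p _).preimage (by fun_prop)
  have hsub : ({0}ᶜ : Set ℝ) ⊆ {s : ℝ | s • z ∈ pPolar p (L : Set (X × (X →L[ℝ] ℝ)))} :=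
    fun s hs => smul_mem_pPolar_of_ne_zero hz hs
  exact closure_minimal hsub hclosed (dense_compl_singleton (0 : ℝ) t)
end
end

section
/- Let X be a real Banach space, let p > q ≥ 1 be integers, and let T : X ⇉ X* be a linear p-monotone multivalued operator with norm-closed domain. If T is pre-maximal q-monotone, then T is pre-maximal p-monotone. -/
open scoped BigOperators

noncomputable section

variable {X : Type*} [NormedAddCommGroup X] [NormedSpace ℝ X]

theorem Submodule.exists_ne_zero_of_notMem_isClosed (M : Submodule ℝ X)
    (hM : IsClosed (M : Set X)) {x : X} (hx : x ∉ M) :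
    ∃ f : X →L[ℝ] ℝ, f x ≠ 0 ∧ ∀ y ∈ M, f y = 0 := by
  obtain ⟨f, u, hfu, hux⟩ := geometric_hahn_banach_closed_point M.convex hM hx
  have hu : 0 < u := by simpa using hfu 0 M.zero_mem
  refine ⟨f, (hu.trans hux).ne', fun y hy => ?_⟩
  by_contra hne
  have h := hfu _ (M.smul_mem (u / f y) hy)
  simp [hne] at h

theorem cyclicSum_eq_sum_add (n : ℕ) (a : Fin (n + 1) → X × (X →L[ℝ] ℝ)) :
    cyclicSum n a = (∑ i : Fin n, (a i.castSucc).2 ((a i.succ).1 - (a i.castSucc).1)) +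
      (a (Fin.last n)).2 ((a 0).1 - (a (Fin.last n)).1) := by
  simp only [cyclicSum, Fin.sum_univ_castSucc, Fin.coeSucc_eq_succ, Fin.last_add_one]

/-- Repeating the last point of a cycle does not change the cyclic sum. -/
theorem cyclicSum_snoc_last (n : ℕ) (a : Fin (n + 1) → X × (X →L[ℝ] ℝ)) :
    cyclicSum (n + 1) (Fin.snoc (α := fun _ => X × (X →L[ℝ] ℝ)) a (a (Fin.last n))) =
      cyclicSum n a := by
  have h0 : (Fin.snoc (α := fun _ => X × (X →L[ℝ] ℝ)) a (a (Fin.last n)) : Fin (n + 2) → _) 0 =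
      a 0 := Fin.snoc_castSucc (α := fun _ => X × (X →L[ℝ] ℝ)) _ a 0
  rw [cyclicSum_eq_sum_add, cyclicSum_eq_sum_add, Fin.sum_univ_castSucc, h0]
  simp only [Fin.succ_castSucc, Fin.snoc_castSucc, Fin.snoc_last, Fin.succ_last, sub_self,
    map_zero, add_zero]

theorem cyclicSum_one (z w : X × (X →L[ℝ] ℝ)) :
    cyclicSum 1 ![z, w] = -((z.2 - w.2) (z.1 - w.1)) := by
  simp [cyclicSum_eq_sum_add]
  ring

variable {T S : Set (X × (X →L[ℝ] ℝ))}

theorem IsPMonotone.anti {p q : ℕ} (hqp : q ≤ p) (hT : IsPMonotone p T) : IsPMonotone q T := by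
  induction hqp with
  | refl => exact hT
  | step _ ih =>
    refine ih fun a ha => ?_
    rw [← cyclicSum_snoc_last]
    refine hT _ fun i => ?_
    refine Fin.lastCases ?_ (fun j => ?_) i
    · simpa using ha _
    · simpa using ha j

theorem IsPMonotone.isMonotoneOp (hT : IsPMonotone 1 T) : IsMonotoneOp T := by
  intro z hz w hw
  have h := hT ![z, w] (by simp [Fin.forall_fin_two, hz, hw])
  rw [cyclicSum_one] at h
  linarith

theorem pPolar_anti_s13 {p q : ℕ} (hq : 1 ≤ q) (hqp : q ≤ p) : pPolar p T ⊆ pPolar q T := by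
  induction p, hqp using Nat.le_induction with
  | base => exact subset_rfl
  | succ n hn ih =>
    intro z hz
    refine ih fun a ha0 ha => ?_
    rw [← cyclicSum_snoc_last]
    refine hz _ ?_ fun i => ?_
    · rw [← ha0]
      exact Fin.snoc_castSucc (α := fun _ => X × (X →L[ℝ] ℝ)) _ a 0
    · refine Fin.lastCases (fun _ => ?_) (fun j hj => ?_) i
      · rw [Fin.snoc_last]
        exact ha _ (by simp [Fin.ext_iff]; omega)
      · rw [Fin.snoc_castSucc]
        exact ha j fun h => hj (by simp [h])

theorem IsPMonotone.subset_pPolar {p : ℕ} (hS : IsPMonotone p S) (hTS : T ⊆ S) :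
    S ⊆ pPolar p T := by
  rintro z hz a rfl ha
  refine hS a fun i => ?_
  by_cases hi : i = 0
  · rwa [hi]
  · exact hTS (ha i hi)

/-- The operator `x ↦ T x + (dom T)^⊥`. -/
def addAnnihilator (T : Set (X × (X →L[ℝ] ℝ))) : Set (X × (X →L[ℝ] ℝ)) :=
  {z | ∃ u, (z.1, u) ∈ T ∧ ∀ y ∈ opDom T, z.2 y = u y}

theorem subset_addAnnihilator : T ⊆ addAnnihilator T :=
  fun z hz => ⟨z.2, hz, fun _ _ => rfl⟩

theorem IsPMonotone.addAnnihilator {p : ℕ} (hT : IsPMonotone p T) :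
    IsPMonotone p (addAnnihilator T) := by
  intro a ha
  choose u hu hua using ha
  refine le_trans (le_of_eq (Finset.sum_congr rfl fun i _ => ?_))
    (hT (fun i => ((a i).1, u i)) hu)
  simp only [map_sub, hua i _ ⟨_, hu _⟩]

/-- A linear operator with closed domain has no monotone extension beyond the one obtained by
adding the annihilator of its domain. -/
theorem IsMonotoneOp.subset_addAnnihilator (L : Submodule ℝ (X × (X →L[ℝ] ℝ)))
    (hdom : IsClosed (opDom (L : Set (X × (X →L[ℝ] ℝ))))) (hS : IsMonotoneOp S)
    (hLS : addAnnihilator (L : Set (X × (X →L[ℝ] ℝ))) ⊆ S) :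
    S ⊆ addAnnihilator (L : Set (X × (X →L[ℝ] ℝ))) := by
  rintro ⟨x, v⟩ hz
  have hD : opDom (L : Set (X × (X →L[ℝ] ℝ))) =
      (L.map (LinearMap.fst ℝ X (X →L[ℝ] ℝ)) : Set X) := by
    ext y
    simp [opDom]
  have hx : x ∈ opDom (L : Set (X × (X →L[ℝ] ℝ))) := by
    by_contra hx
    obtain ⟨f, hfx, hf⟩ : ∃ f : X →L[ℝ] ℝ, f x ≠ 0 ∧
        ∀ y ∈ opDom (L : Set (X × (X →L[ℝ] ℝ))), f y = 0 := by
      rw [hD] at hx hdom ⊢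
      exact Submodule.exists_ne_zero_of_notMem_isClosed _ hdom hx
    have h := hS _ hz (0, ((v x + 1) / f x) • f)
      (hLS ⟨0, L.zero_mem, fun y hy => by simp [hf y hy]⟩)
    simp [hfx] at h
    linarith
  obtain ⟨u, hu⟩ := hx
  refine ⟨u, hu, ?_⟩
  rintro y ⟨w, hw⟩
  have h : ∀ t : ℝ, 0 ≤ w y * (t * t) + (u y - v y) * t + 0 := by
    intro t
    have h := hS _ hz _ (hLS (_root_.subset_addAnnihilator (L.add_mem hu (L.smul_mem t hw))))
    simp at h
    linarith
  have h := discrim_le_zero h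
  simp only [discrim, mul_zero, sub_zero] at h
  exact (sub_eq_zero.1 (pow_eq_zero_iff two_ne_zero |>.1 (le_antisymm h (sq_nonneg _)))).symm

/-- If `p > q ≥ 1`, `T` is linear, `p`-monotone, with norm-closed domain, and `T`
is pre-maximal `q`-monotone, then `T` is pre-maximal `p`-monotone. -/
theorem preMax_q_implies_preMax_p [CompleteSpace X] (p q : ℕ) (hq : 1 ≤ q) (hqp : q < p)
    (T : Set (X × (X →L[ℝ] ℝ)))
    (hlin : ∃ L : Submodule ℝ (X × (X →L[ℝ] ℝ)), T = ↑L)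
    (hT : IsPMonotone p T) (hdom : IsClosed (opDom T))
    (hpre : IsPreMaxPMonotone q T) :
    IsPreMaxPMonotone p T := by
  obtain ⟨L, rfl⟩ := hlin
  have hqT := hT.addAnnihilator.anti hqp.le
  have hsub := (hpre.2.anti hq).isMonotoneOp.subset_addAnnihilator L hdom
    (hqT.subset_pPolar subset_addAnnihilator)
  exact ⟨hT, fun a ha => hT.addAnnihilator a fun i => hsub (pPolar_anti_s13 hq hqp.le (ha i))⟩
end
end

section
/- Let X be a real Banach space, p ≥ 1 an integer, and T : X ⇉ X* a maximal p-monotone multivalued operator whose graph is convex. Then T is affine linear, i.e., the graph of T is an affine subspace of X × X*. Moreover, if dom(T) is norm-closed, then T is maximal monotone. -/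
open scoped BigOperators

noncomputable section

variable {X : Type*} [NormedAddCommGroup X] [NormedSpace ℝ X]

/-- Cyclic sums are invariant under translation and quadratic under scaling. -/
lemma cyclicSum_smul_sub (p : ℕ) (a : Fin (p + 1) → X × (X →L[ℝ] ℝ)) (r : ℝ)
    (c : X × (X →L[ℝ] ℝ)) :
    cyclicSum p (fun i => r • a i - c) = r ^ 2 * cyclicSum p a := by
  have htel : ∑ i : Fin (p + 1), (c.2 (a (i + 1)).1 - c.2 (a i).1) = 0 := by
    rw [Finset.sum_sub_distrib, sub_eq_zero]
    exact Equiv.sum_comp (Equiv.addRight (1 : Fin (p + 1))) fun i => c.2 (a i).1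
  have h : cyclicSum p (fun i => r • a i - c) = r ^ 2 * cyclicSum p a
      - r * ∑ i : Fin (p + 1), (c.2 (a (i + 1)).1 - c.2 (a i).1) := by
    unfold cyclicSum
    rw [Finset.mul_sum, Finset.mul_sum, ← Finset.sum_sub_distrib]
    refine Finset.sum_congr rfl fun i _ => ?_
    simp only [Prod.snd_sub, Prod.fst_sub, Prod.smul_fst, Prod.smul_snd,
      sub_apply, smul_apply, map_sub, map_smul,
      smul_eq_mul]
    ring
  rw [h, htel, mul_zero, sub_zero]

lemma IsPMonotone.extrapolate {p : ℕ} {T : Set (X × (X →L[ℝ] ℝ))} (hT : IsPMonotone p T)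
    (hconv : Convex ℝ T) {t : ℝ} (ht : 0 ≤ t) :
    IsPMonotone p {z | ∃ u ∈ T, ∃ v ∈ T, z = (1 + t) • u - t • v} := by
  intro a ha
  choose u hu v hv hz using ha
  set r : ℝ := 1 + t + t * p
  have hr : 0 < r := by positivity
  have hmem : ∀ i, r⁻¹ • ((1 + t) • u i + ∑ j ∈ Finset.univ.erase i, t • v j) ∈ T := by
    intro i
    have hsum : ∑ j, (if j = i then r⁻¹ * (1 + t) else r⁻¹ * t) •
        (if j = i then u j else v j) ∈ T := by
      refine hconv.sum_mem (fun j _ => ?_) ?_ fun j _ => ?_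
      · split_ifs <;> positivity
      · rw [← Finset.add_sum_erase _ _ (Finset.mem_univ i), if_pos rfl,
          Finset.sum_congr rfl fun j hj => if_neg (Finset.ne_of_mem_erase hj)]
        simp only [Finset.sum_const, Finset.card_erase_of_mem (Finset.mem_univ i),
          Finset.card_univ, Fintype.card_fin, Nat.add_sub_cancel, nsmul_eq_mul]
        field_simp
        simp only [r]
      · split_ifs
        exacts [hu j, hv j]
    convert hsum using 1
    rw [← Finset.add_sum_erase _ _ (Finset.mem_univ i), smul_add, Finset.smul_sum]
    simp only [if_true, mul_smul]
    congr 1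
    refine Finset.sum_congr rfl fun j hj => ?_
    simp only [if_neg (Finset.ne_of_mem_erase hj), mul_smul]
  have key := cyclicSum_smul_sub p
    (fun i => r⁻¹ • ((1 + t) • u i + ∑ j ∈ Finset.univ.erase i, t • v j)) r (∑ j, t • v j)
  have ha : a = fun i => r • r⁻¹ • ((1 + t) • u i + ∑ j ∈ Finset.univ.erase i, t • v j)
      - ∑ j, t • v j := by
    funext i
    rw [smul_inv_smul₀ hr.ne', hz i, ← Finset.add_sum_erase _ _ (Finset.mem_univ i)]
    abel
  rw [ha, key]
  exact mul_nonpos_of_nonneg_of_nonpos (sq_nonneg r) (hT _ hmem)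

lemma IsMaxPMonotone.smul_sub_add_mem {p : ℕ} {T : Set (X × (X →L[ℝ] ℝ))}
    (hT : IsMaxPMonotone p T) (hconv : Convex ℝ T) (c : ℝ) {u v w : X × (X →L[ℝ] ℝ)}
    (hu : u ∈ T) (hv : v ∈ T) (hw : w ∈ T) : c • (u - v) + w ∈ T := by
  have extr : ∀ t : ℝ, 0 ≤ t → ∀ x ∈ T, ∀ y ∈ T, (1 + t) • x - t • y ∈ T := by
    intro t ht x hx y hy
    rw [← hT.2 _ (hT.1.extrapolate hconv ht) fun z hz => ⟨z, hz, z, hz, by module⟩]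
    exact ⟨x, hx, y, hy, rfl⟩
  have main : ∀ t : ℝ, 0 ≤ t → ∀ x ∈ T, ∀ y ∈ T, t • (x - y) + w ∈ T := by
    intro t ht x hx y hy
    have hpos : 0 < 1 + t := by positivity
    have hq : (t / (1 + t)) • x + (1 / (1 + t)) • w ∈ T :=
      hconv hx hw (by positivity) (by positivity) (by field_simp; ring)
    convert extr t ht _ hq y hy using 1
    match_scalars <;> field_simp
  rcases le_total 0 c with hc | hc
  · exact main c hc u hu v hv
  · convert main (-c) (neg_nonneg.2 hc) v hv u hu using 1
    module

lemma IsMaxPMonotone.nonempty {p : ℕ} {T : Set (X × (X →L[ℝ] ℝ))}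
    (hT : IsMaxPMonotone p T) : T.Nonempty := by
  by_contra h
  rw [Set.not_nonempty_iff_eq_empty] at h
  have hS : IsPMonotone p ({0} : Set (X × (X →L[ℝ] ℝ))) := by
    intro a ha
    simp only [Set.mem_singleton_iff] at ha
    simp [cyclicSum, ha]
  exact Set.singleton_ne_empty _ ((hT.2 _ hS (h ▸ Set.empty_subset _)).trans h)

/-- A maximal `p`-monotone operator absorbs functionals which are constant on its domain. -/
lemma IsMaxPMonotone.add_mem {p : ℕ} {T : Set (X × (X →L[ℝ] ℝ))}
    (hT : IsMaxPMonotone p T) {f : X →L[ℝ] ℝ} (hf : ∀ v ∈ T, ∀ w ∈ T, f v.1 = f w.1)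
    {z : X × (X →L[ℝ] ℝ)} (hz : z ∈ T) : (z.1, z.2 + f) ∈ T := by
  have hS : IsPMonotone p
      {z | ∃ w ∈ T, ∃ c : ℝ, z = (w.1, w.2 + c • f)} := by
    intro a ha
    choose w hw c hc using ha
    convert hT.1 w hw using 1
    refine Finset.sum_congr rfl fun i _ => ?_
    simp [hc, hf _ (hw (i + 1)) _ (hw i)]
  rw [← hT.2 _ hS fun w hw => ⟨w, hw, 0, by simp⟩]
  exact ⟨z, hz, 1, by simp⟩

lemma IsPMonotone.isMonotoneOp_s14 {p : ℕ} (hp : 1 ≤ p) {T : Set (X × (X →L[ℝ] ℝ))}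
    (hT : IsPMonotone p T) : IsMonotoneOp T := by
  obtain ⟨q, rfl⟩ := Nat.exists_eq_add_of_le' hp
  intro z hz w hw
  have h := hT (Fin.cons z fun _ => w) fun i => by
    refine Fin.cases ?_ (fun _ => ?_) i
    exacts [hz, hw]
  rw [cyclicSum, Fin.sum_univ_succ, Fin.sum_univ_castSucc] at h
  have h1 : (0 : Fin (q + 1 + 1)) + 1 = Fin.succ 0 := by simp
  have h2 : ∀ i : Fin q, (Fin.castSucc i).succ + 1 = (Fin.succ i).succ := by
    intro i
    rw [Fin.succ_castSucc, Fin.coeSucc_eq_succ]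
  have h3 : (Fin.last q).succ + 1 = 0 := by
    rw [Fin.succ_last, Fin.last_add_one]
  rw [h1, h3] at h
  simp only [h2, Fin.cons_succ, Fin.cons_zero, sub_self, map_zero, Finset.sum_const_zero,
    zero_add, map_sub] at h
  simp only [sub_apply, map_sub]
  linarith

lemma IsMonotoneOp.isPMonotone_one {T : Set (X × (X →L[ℝ] ℝ))} (hT : IsMonotoneOp T) :
    IsPMonotone 1 T := by
  intro a ha
  have h := hT _ (ha 0) _ (ha 1)
  have h1 : (1 : Fin 2) + 1 = 0 := rfl
  change ∑ i : Fin 2, (a i).2 ((a (i + 1)).1 - (a i).1) ≤ 0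
  simp only [Fin.sum_univ_two, zero_add, h1, map_sub]
  simp only [sub_apply, map_sub] at h
  linarith

lemma eq_zero_of_forall_mul_le {b c : ℝ} (h : ∀ t : ℝ, t * b ≤ c) : b = 0 := by
  by_contra hb
  have := h ((c + 1) / b)
  rw [div_mul_cancel₀ _ hb] at this
  linarith

lemma eq_zero_of_forall_mul_le_sq {b c : ℝ} (h : ∀ t : ℝ, t * b ≤ t ^ 2 * c) : b = 0 := by
  by_contra hb
  have hc := abs_nonneg c
  have hb2 : 0 < b ^ 2 := by positivity
  have := h (b / (|c| + 1))
  rw [div_pow, div_mul_eq_mul_div, div_mul_eq_mul_div, div_le_div_iff₀ (by positivity)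
    (by positivity)] at this
  nlinarith [le_abs_self c, mul_pos hb2 (by positivity : 0 < |c| + 1)]

lemma IsMaxPMonotone.isMaxPMonotone_one {p : ℕ} (hp : 1 ≤ p) {T : Set (X × (X →L[ℝ] ℝ))}
    (hT : IsMaxPMonotone p T) (hconv : Convex ℝ T) (hcl : IsClosed (opDom T)) :
    IsMaxPMonotone 1 T := by
  refine ⟨(hT.1.isMonotoneOp_s14 hp).isPMonotone_one, fun S hS hTS => ?_⟩
  refine Set.Subset.antisymm (fun s hs => ?_) hTS
  have hmono : ∀ w ∈ T, 0 ≤ (s.2 - w.2) (s.1 - w.1) := fun w hw =>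
    hS.isMonotoneOp_s14 le_rfl s hs w (hTS hw)
  obtain ⟨w₀, hw₀⟩ := hT.nonempty
  have hdom : s.1 ∈ opDom T := by
    by_contra hx
    have hconvD : Convex ℝ (opDom T) := by
      rintro x ⟨x', hx'⟩ y ⟨y', hy'⟩ a b ha hb hab
      exact ⟨_, hconv hx' hy' ha hb hab⟩
    obtain ⟨f, u, hfs, hf⟩ := geometric_hahn_banach_point_closed hconvD hcl hx
    have hconst : ∀ v ∈ T, ∀ w ∈ T, f v.1 = f w.1 := by
      intro v hv w hw
      refine sub_eq_zero.1 (eq_zero_of_forall_mul_le (c := f v.1 - u) fun t => ?_)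
      have := hf _ ⟨_, hT.smul_sub_add_mem hconv (-t) hv hw hv⟩
      simp only [Prod.smul_fst, Prod.fst_sub, map_add, map_smul, map_sub, smul_eq_mul] at this
      linarith
    have hzero : f (s.1 - w₀.1) = 0 := by
      refine eq_zero_of_forall_mul_le (c := (s.2 - w₀.2) (s.1 - w₀.1)) fun t => ?_
      have := hmono _ (hT.add_mem (f := t • f) (fun v hv w hw => by simp [hconst v hv w hw]) hw₀)
      simp only [sub_apply, add_apply,
        smul_apply, smul_eq_mul] at this ⊢
      linarith
    have := hf _ ⟨_, hw₀⟩
    rw [map_sub] at hzero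
    linarith
  obtain ⟨y, hy⟩ := hdom
  have hconst : ∀ v ∈ T, ∀ w ∈ T, (s.2 - y) v.1 = (s.2 - y) w.1 := by
    intro v hv w hw
    rw [← sub_eq_zero, ← map_sub]
    refine eq_zero_of_forall_mul_le_sq (c := (v.2 - w.2) (v.1 - w.1)) fun t => ?_
    have := hmono _ (hT.smul_sub_add_mem hconv t hv hw hy)
    simp only [Prod.fst_add, Prod.smul_fst, Prod.fst_sub, Prod.snd_add, Prod.smul_snd,
      Prod.snd_sub, sub_add_cancel_right, sub_apply,
      add_apply, smul_apply, smul_eq_mul, map_neg,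
      map_smul, map_sub] at this ⊢
    linarith
  simpa using hT.add_mem hconst hy

/-- A maximal `p`-monotone operator with convex graph is affine linear; moreover,
if its domain is norm-closed then it is maximal monotone (= maximal 1-monotone). -/
theorem maxPMonotone_convex_graph_affine [CompleteSpace X] (p : ℕ) (hp : 1 ≤ p)
    (T : Set (X × (X →L[ℝ] ℝ))) (hT : IsMaxPMonotone p T) (hconv : Convex ℝ T) :
    (∃ A : AffineSubspace ℝ (X × (X →L[ℝ] ℝ)), T = ↑A) ∧
      (IsClosed (opDom T) → IsMaxPMonotone 1 T) := by
  refine ⟨⟨⟨T, fun c u v w hu hv hw => ?_⟩, rfl⟩, hT.isMaxPMonotone_one hp hconv⟩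
  exact hT.smul_sub_add_mem hconv c hu hv hw
end
end
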